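/- The value function for the initial-boundary variational problem satisfies the dynamic programming principle: for all x ≥ 0 and 0 ≤ s < t, W(x,t) = W(x,t,s), where W(x,t) minimizes over Lipschitz curves on [0,t] ending at x in the quarter plane, and W(x,t,s) minimizes over curves on [s,t] ending at x with terminal cost W(γ(s),s). -/

import Mathlib

open Real Set Filter MeasureTheory intervalIntegral

/-- Convex conjugate of `f`. -/
noncomputable def conjFn (f : ℝ → ℝ) (u : ℝ) : ℝ := ⨆ v : ℝ, (u * v - f v)

/-- Running cost of a curve `γ` on `[s,t]`:
`∫_{{γ≠0}} f*(γ') e^{-β} - ∫_{{γ=0}} f(ū_b) e^{-β}`, where `ū_b θ = max (u_b θ) λ_f`. -/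
noncomputable def runCost (f β ub : ℝ → ℝ) (lf : ℝ) (γ : ℝ → ℝ) (s t : ℝ) : ℝ :=
  ∫ θ in s..t,
    (if γ θ = 0 then -(f (max (ub θ) lf)) else conjFn f (deriv γ θ)) *
      Real.exp (-β θ)

/-- Value function `W(x,t)`: infimum of the cost over Lipschitz curves
`γ : [0,t] → [0,∞)` with `γ t = x`, with initial cost `W₀(γ 0) = ∫₀^{γ 0} u₀`. -/
noncomputable def Wval (f β ub u₀ : ℝ → ℝ) (lf x t : ℝ) : ℝ :=
  sInf {c : ℝ | ∃ γ : ℝ → ℝ, ∃ K : NNReal,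
    LipschitzOnWith K γ (Set.Icc 0 t) ∧ γ t = x ∧
    (∀ θ ∈ Set.Icc (0:ℝ) t, 0 ≤ γ θ) ∧
    c = runCost f β ub lf γ 0 t + ∫ y in (0:ℝ)..(γ 0), u₀ y}

/-- Value function `W(x,t,s)`: infimum over Lipschitz curves `γ : [s,t] → [0,∞)`
with `γ t = x` and terminal cost `W(γ s, s)`. -/
noncomputable def Wvals (f β ub u₀ : ℝ → ℝ) (lf x t s : ℝ) : ℝ :=
  sInf {c : ℝ | ∃ γ : ℝ → ℝ, ∃ K : NNReal,
    LipschitzOnWith K γ (Set.Icc s t) ∧ γ t = x ∧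
    (∀ θ ∈ Set.Icc s t, 0 ≤ γ θ) ∧
    c = runCost f β ub lf γ s t + Wval f β ub u₀ lf (γ s) s}

/-- The integrand of `runCost`. -/
noncomputable def runDensity (f β ub : ℝ → ℝ) (lf : ℝ) (γ : ℝ → ℝ) (θ : ℝ) : ℝ :=
  (if γ θ = 0 then -(f (max (ub θ) lf)) else conjFn f (deriv γ θ)) * Real.exp (-β θ)

/-- A continuous function with superlinear growth has finite convex conjugate. -/
lemma bddAbove_conjFn {f : ℝ → ℝ} (hf : Continuous f)
    (hsuper : Tendsto (fun u => f u / |u|) (cocompact ℝ) atTop) (u : ℝ) :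
    BddAbove (range fun v : ℝ => u * v - f v) := by
  have h1 : ∀ᶠ v in cocompact ℝ, |u| ≤ f v / |v| := hsuper.eventually_ge_atTop _
  obtain ⟨k, hk, hsub⟩ := mem_cocompact.1 h1
  obtain ⟨M, hM⟩ := (hk.image (f := fun v => u * v - f v) (by fun_prop)).bddAbove
  refine ⟨max M (max 0 (u * 0 - f 0)), ?_⟩
  rintro _ ⟨v, rfl⟩
  by_cases hv : v ∈ k
  · exact le_max_of_le_left (hM ⟨v, hv, rfl⟩)
  · rcases eq_or_ne v 0 with rfl | hv0
    · exact le_max_of_le_right (le_max_right _ _)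
    · have h2 : |u| ≤ f v / |v| := hsub hv
      rw [le_div_iff₀ (abs_pos.2 hv0), ← abs_mul] at h2
      refine le_max_of_le_right (le_max_of_le_left ?_)
      dsimp only
      linarith [le_abs_self (u * v)]

/-- The convex conjugate of a continuous function with superlinear growth is continuous. -/
lemma continuous_conjFn {f : ℝ → ℝ} (hf : Continuous f)
    (hsuper : Tendsto (fun u => f u / |u|) (cocompact ℝ) atTop) : Continuous (conjFn f) := by
  have hconv : ConvexOn ℝ univ (conjFn f) := by
    refine ⟨convex_univ, fun p _ q _ a b ha hb hab => ciSup_le fun v => ?_⟩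
    have h1 := mul_le_mul_of_nonneg_left (le_ciSup (bddAbove_conjFn hf hsuper p) v) ha
    have h2 := mul_le_mul_of_nonneg_left (le_ciSup (bddAbove_conjFn hf hsuper q) v) hb
    simp only [smul_eq_mul]
    unfold conjFn
    have h3 : (a * p + b * q) * v - f v = a * (p * v - f v) + b * (q * v - f v) := by
      linear_combination (f v) * hab
    linarith
  exact continuousOn_univ.1 (hconv.continuousOn isOpen_univ)

/-- `runCost` depends only on the curve inside the open interval. -/
lemma runCost_congr {f β ub : ℝ → ℝ} {lf : ℝ} {γ η : ℝ → ℝ} {a b : ℝ} (hab : a ≤ b)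
    (h : EqOn γ η (Ioo a b)) : runCost f β ub lf γ a b = runCost f β ub lf η a b := by
  simp only [runCost, integral_of_le hab, integral_Ioc_eq_integral_Ioo]
  refine setIntegral_congr_fun measurableSet_Ioo fun θ hθ => ?_
  have h1 : deriv γ θ = deriv η θ :=
    (h.eventuallyEq_of_mem (isOpen_Ioo.mem_nhds hθ)).deriv_eq
  simp only [h hθ, h1]

/-- The running cost density of a Lipschitz curve is integrable. -/
lemma intervalIntegrable_runDensity {f β ub : ℝ → ℝ} {lf : ℝ} (hf : Continuous f)
    (hsuper : Tendsto (fun u => f u / |u|) (cocompact ℝ) atTop) (hβ : Continuous β)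
    (hub : ∃ M, ∀ θ, |ub θ| ≤ M) (hubm : Measurable ub) {γ : ℝ → ℝ} {K : NNReal} {a b : ℝ}
    (hab : a ≤ b) (hγ : LipschitzOnWith K γ (Icc a b)) :
    IntervalIntegrable (runDensity f β ub lf γ) volume a b := by
  have hc := continuous_conjFn hf hsuper
  obtain ⟨g, hg, hgγ⟩ := hγ.extend_real
  obtain ⟨M, hM⟩ := hub
  obtain ⟨A, hA⟩ := (isCompact_Icc (a := -M) (b := max M lf)).exists_bound_of_continuousOn
    hf.continuousOn
  obtain ⟨B, hB⟩ := (isCompact_Icc (a := -(K : ℝ)) (b := K)).exists_bound_of_continuousOn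
    hc.continuousOn
  obtain ⟨E, hE⟩ := (isCompact_Icc (a := a) (b := b)).exists_bound_of_continuousOn
    (f := fun θ => Real.exp (-β θ)) (by fun_prop)
  have hmeas : Measurable (runDensity f β ub lf g) := by
    refine Measurable.mul (Measurable.ite ?_ ?_ ?_) (by fun_prop)
    · exact (isClosed_singleton.preimage hg.continuous).measurableSet
    · exact (hf.measurable.comp (hubm.max measurable_const)).neg
    · exact hc.measurable.comp (measurable_deriv g)
  have hint : IntegrableOn (runDensity f β ub lf g) (Ioo a b) := by
    refine Measure.integrableOn_of_bounded (M := max A B * E) (by simp)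
      hmeas.aestronglyMeasurable ?_
    refine (ae_restrict_iff' measurableSet_Ioo).2 (ae_of_all _ fun θ hθ => ?_)
    have hE' := hE θ (Ioo_subset_Icc_self hθ)
    have hM' := abs_le.1 (hM θ)
    have hA' := hA (max (ub θ) lf)
      ⟨le_max_of_le_left hM'.1, max_le_max_right _ hM'.2⟩
    have hB' := hB (deriv g θ) (abs_le.1 (norm_deriv_le_of_lipschitz hg))
    rw [runDensity, norm_mul]
    refine mul_le_mul ?_ hE' (norm_nonneg _)
      (((norm_nonneg _).trans hA').trans (le_max_left _ _))
    split_ifs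
    · rw [norm_neg]; exact hA'.trans (le_max_left _ _)
    · exact hB'.trans (le_max_right _ _)
  rw [intervalIntegrable_iff_integrableOn_Ioo_of_le hab]
  refine hint.congr_fun (fun θ hθ => ?_) measurableSet_Ioo
  have h : EqOn γ g (Ioo a b) := hgγ.mono Ioo_subset_Icc_self
  have h1 : deriv γ θ = deriv g θ :=
    (h.eventuallyEq_of_mem (isOpen_Ioo.mem_nhds hθ)).deriv_eq
  simp only [runDensity, h hθ, h1]

/-- Additivity of the running cost in time. -/
lemma runCost_add {f β ub : ℝ → ℝ} {lf : ℝ} (hf : Continuous f)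
    (hsuper : Tendsto (fun u => f u / |u|) (cocompact ℝ) atTop) (hβ : Continuous β)
    (hub : ∃ M, ∀ θ, |ub θ| ≤ M) (hubm : Measurable ub) {γ : ℝ → ℝ} {K : NNReal} {a b c : ℝ}
    (hab : a ≤ b) (hbc : b ≤ c) (hγ : LipschitzOnWith K γ (Icc a c)) :
    runCost f β ub lf γ a c = runCost f β ub lf γ a b + runCost f β ub lf γ b c :=
  (integral_add_adjacent_intervals
    (intervalIntegrable_runDensity hf hsuper hβ hub hubm hab
      (hγ.mono (Icc_subset_Icc_right hbc)))
    (intervalIntegrable_runDensity hf hsuper hβ hub hubm hbc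
      (hγ.mono (Icc_subset_Icc_left hab)))).symm

/-- The running cost of a nonnegative Lipschitz curve dominates an affine function of its
displacement, with any prescribed slope. -/
lemma exists_runCost_ge {f β ub : ℝ → ℝ} {lf : ℝ} (hf : Continuous f)
    (hsuper : Tendsto (fun u => f u / |u|) (cocompact ℝ) atTop) (hβ : Continuous β)
    (hub : ∃ M, ∀ θ, |ub θ| ≤ M) (hubm : Measurable ub) (m t : ℝ) :
    ∃ C : ℝ, ∀ (γ : ℝ → ℝ) (K : NNReal) (a b : ℝ), 0 ≤ a → a ≤ b → b ≤ t →
      LipschitzOnWith K γ (Icc a b) → (∀ θ ∈ Icc a b, 0 ≤ γ θ) →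
      m * (γ b - γ a) - C * (b - a) ≤ runCost f β ub lf γ a b := by
  obtain ⟨M, hM⟩ := hub
  obtain ⟨A, hA⟩ := (isCompact_Icc (a := -M) (b := max M lf)).exists_bound_of_continuousOn
    hf.continuousOn
  obtain ⟨E, hE⟩ := (isCompact_Icc (a := 0) (b := t)).exists_bound_of_continuousOn
    (f := fun θ => Real.exp (-β θ)) (by fun_prop)
  obtain ⟨D, hD⟩ := (isCompact_Icc (a := 0) (b := t)).exists_bound_of_continuousOn
    (f := fun θ => Real.exp (-β θ) * f (m * Real.exp (β θ))) (by fun_prop)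
  refine ⟨max (A * E) D, fun γ K a b ha hab hbt hγ hpos => ?_⟩
  have hac : AbsolutelyContinuousOnInterval γ a b :=
    LipschitzOnWith.absolutelyContinuousOnInterval (K := K) (by rwa [uIcc_of_le hab])
  have hi := hac.intervalIntegrable_deriv
  have hFTC := hac.integral_deriv_eq_sub
  have heq : ∫ θ in a..b, (m * deriv γ θ - max (A * E) D) =
      m * (γ b - γ a) - max (A * E) D * (b - a) := by
    rw [intervalIntegral.integral_sub (hi.const_mul m) intervalIntegrable_const,
      intervalIntegral.integral_const_mul, hFTC, intervalIntegral.integral_const, smul_eq_mul]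
    ring
  rw [← heq]
  refine integral_mono_on_of_le_Ioo hab ((hi.const_mul m).sub intervalIntegrable_const)
    (intervalIntegrable_runDensity hf hsuper hβ ⟨M, hM⟩ hubm hab hγ) fun θ hθ => ?_
  have hθt : θ ∈ Icc 0 t := ⟨ha.trans hθ.1.le, hθ.2.le.trans hbt⟩
  have hnhds : Icc a b ∈ nhds θ := Icc_mem_nhds hθ.1 hθ.2
  split_ifs with h0
  · have hmin : IsLocalMin γ θ := by
      filter_upwards [hnhds] with y hy
      rw [h0]
      exact hpos y hy
    have hM' := abs_le.1 (hM θ)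
    have hA' := hA (max (ub θ) lf) ⟨le_max_of_le_left hM'.1, max_le_max_right _ hM'.2⟩
    have hE' := hE θ hθt
    have hAE : f (max (ub θ) lf) * Real.exp (-β θ) ≤ A * E :=
      mul_le_mul ((le_abs_self _).trans hA') ((le_abs_self _).trans hE') (Real.exp_pos _).le
        ((norm_nonneg _).trans hA')
    rw [hmin.deriv_eq_zero]
    linarith [le_max_left (A * E) D]
  · have h1 := le_ciSup (bddAbove_conjFn hf hsuper (deriv γ θ)) (m * Real.exp (β θ))
    have h2 := mul_le_mul_of_nonneg_right h1 (Real.exp_pos (-β θ)).le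
    have h3 := (le_abs_self _).trans (hD θ hθt)
    have h4 : Real.exp (β θ) * Real.exp (-β θ) = 1 := by
      rw [← Real.exp_add]; simp
    have h5 : (deriv γ θ * (m * Real.exp (β θ)) - f (m * Real.exp (β θ))) * Real.exp (-β θ)
        = m * deriv γ θ - Real.exp (-β θ) * f (m * Real.exp (β θ)) := by
      linear_combination (deriv γ θ * m) * h4
    unfold conjFn
    linarith [le_max_right (A * E) D]

/-- Concatenation of two Lipschitz curves that agree at the junction. -/
lemma LipschitzOnWith.ite_le_Icc {γ η : ℝ → ℝ} {K L : NNReal} {a b c : ℝ}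
    (hγ : LipschitzOnWith K γ (Icc a b)) (hη : LipschitzOnWith L η (Icc b c))
    (h : γ b = η b) :
    LipschitzOnWith (max K L) (fun θ => if θ ≤ b then γ θ else η θ) (Icc a c) := by
  have key : ∀ p ∈ Icc a c, ∀ q ∈ Icc a c, p ≤ q →
      |(if p ≤ b then γ p else η p) - (if q ≤ b then γ q else η q)|
        ≤ ((max K L : NNReal) : ℝ) * |p - q| := by
    intro p hp q hq hpq
    have hK : (K : ℝ) ≤ ((max K L : NNReal) : ℝ) := by exact_mod_cast le_max_left K L
    have hL : (L : ℝ) ≤ ((max K L : NNReal) : ℝ) := by exact_mod_cast le_max_right K L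
    have h1 : ∀ p ∈ Icc a b, ∀ q ∈ Icc a b, |γ p - γ q| ≤ ((max K L : NNReal) : ℝ) * |p - q| :=
      fun p hp q hq => (hγ.dist_le_mul p hp q hq).trans
        (mul_le_mul_of_nonneg_right hK dist_nonneg)
    have h2 : ∀ p ∈ Icc b c, ∀ q ∈ Icc b c, |η p - η q| ≤ ((max K L : NNReal) : ℝ) * |p - q| :=
      fun p hp q hq => (hη.dist_le_mul p hp q hq).trans
        (mul_le_mul_of_nonneg_right hL dist_nonneg)
    split_ifs with hpb hqb hqb
    · exact h1 p ⟨hp.1, hpb⟩ q ⟨hq.1, hqb⟩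
    · push Not at hqb
      have e1 := h1 p ⟨hp.1, hpb⟩ b ⟨hp.1.trans hpb, le_rfl⟩
      have e2 := h2 b ⟨le_rfl, hqb.le.trans hq.2⟩ q ⟨hqb.le, hq.2⟩
      have e3 := abs_sub_le (γ p) (γ b) (η q)
      rw [abs_of_nonpos (by linarith : p - b ≤ 0)] at e1
      rw [abs_of_nonpos (by linarith : b - q ≤ 0), ← h] at e2
      rw [abs_of_nonpos (by linarith : p - q ≤ 0)]
      linarith
    · exact absurd (hpq.trans hqb) hpb
    · push Not at hpb hqb
      exact h2 p ⟨hpb.le, hp.2⟩ q ⟨hqb.le, hq.2⟩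
  refine LipschitzOnWith.of_dist_le_mul fun p hp q hq => ?_
  rcases le_total p q with hpq | hpq
  · exact key p hp q hq hpq
  · rw [dist_comm, dist_comm p q]
    exact key q hq p hp hpq

/-- Dynamic programming principle: `W(x,t) = W(x,t,s)` for `x ≥ 0`, `0 ≤ s < t`. -/
theorem dynamic_programming_principle (f β ub u₀ : ℝ → ℝ) (lf : ℝ)
    (hf : ContDiff ℝ 2 f)
    (hconv : StrictConvexOn ℝ Set.univ f)
    (hsuper : Tendsto (fun u => f u / |u|) (cocompact ℝ) atTop)
    (hlf : deriv f lf = 0)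
    (hβ : Continuous β)
    (hub : ∃ M, ∀ θ, |ub θ| ≤ M) (hubm : Measurable ub)
    (hu₀ : ∃ M, ∀ y, |u₀ y| ≤ M) (hu₀m : Measurable u₀)
    (x t s : ℝ) (hx : 0 ≤ x) (hs : 0 ≤ s) (hst : s < t) :
    Wval f β ub u₀ lf x t = Wvals f β ub u₀ lf x t s := by
  have hfc := hf.continuous
  obtain ⟨M, hM⟩ := hu₀
  obtain ⟨C, hC⟩ := exists_runCost_ge (lf := lf) hfc hsuper hβ hub hubm (-M) t
  have hinit : ∀ y, 0 ≤ y → -M * y ≤ ∫ z in (0:ℝ)..y, u₀ z := fun y hy => by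
    have h := norm_integral_le_of_norm_le_const (a := 0) (b := y) (f := u₀) (C := M)
      fun z _ => hM z
    rw [sub_zero, abs_of_nonneg hy] at h
    linarith [(abs_le.1 h).1]
  have hlow : ∀ r y, 0 ≤ r → r ≤ t → ∀ c ∈ {c : ℝ | ∃ γ : ℝ → ℝ, ∃ K : NNReal,
      LipschitzOnWith K γ (Set.Icc 0 r) ∧ γ r = y ∧ (∀ θ ∈ Set.Icc (0:ℝ) r, 0 ≤ γ θ) ∧
      c = runCost f β ub lf γ 0 r + ∫ y in (0:ℝ)..(γ 0), u₀ y}, -M * y - C * r ≤ c := by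
    rintro r y hr hrt c ⟨γ, K, hγ, rfl, hpos, rfl⟩
    have h1 := hC γ K 0 r le_rfl hr hrt hγ hpos
    have h2 := hinit (γ 0) (hpos 0 ⟨le_rfl, hr⟩)
    linarith
  have hne : ∀ r y, 0 ≤ y → {c : ℝ | ∃ γ : ℝ → ℝ, ∃ K : NNReal,
      LipschitzOnWith K γ (Set.Icc 0 r) ∧ γ r = y ∧ (∀ θ ∈ Set.Icc (0:ℝ) r, 0 ≤ γ θ) ∧
      c = runCost f β ub lf γ 0 r + ∫ y in (0:ℝ)..(γ 0), u₀ y}.Nonempty :=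
    fun r y hy => ⟨_, fun _ => y, 0, (LipschitzWith.const y).lipschitzOnWith, rfl, fun _ _ => hy, rfl⟩
  apply le_antisymm
  · refine le_csInf ⟨_, fun _ => x, 0, (LipschitzWith.const x).lipschitzOnWith, rfl, fun _ _ => hx, rfl⟩ ?_
    rintro c ⟨η, L, hη, hηt, hηpos, rfl⟩
    rw [← sub_le_iff_le_add']
    refine le_csInf (hne s (η s) (hηpos s ⟨le_rfl, hst.le⟩)) ?_
    rintro d ⟨γ, K, hγ, hγs, hγpos, rfl⟩
    rw [sub_le_iff_le_add']
    refine csInf_le ⟨_, hlow t x (hs.trans hst.le) le_rfl⟩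
      ⟨fun θ => if θ ≤ s then γ θ else η θ, max K L, hγ.ite_le_Icc hη hγs, ?_, ?_, ?_⟩
    · simp [hst.not_ge, hηt]
    · intro θ hθ
      dsimp only
      split_ifs with h
      · exact hγpos θ ⟨hθ.1, h⟩
      · exact hηpos θ ⟨(not_le.1 h).le, hθ.2⟩
    · rw [runCost_add hfc hsuper hβ hub hubm hs hst.le (hγ.ite_le_Icc hη hγs),
        runCost_congr (η := γ) hs fun θ hθ => if_pos hθ.2.le,
        runCost_congr (η := η) hst.le fun θ hθ => if_neg hθ.1.not_ge]
      simp only [hs, if_true]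
      ring
  · refine le_csInf (hne t x hx) ?_
    rintro c ⟨γ, K, hγ, hγt, hγpos, rfl⟩
    have hγs : LipschitzOnWith K γ (Icc 0 s) := hγ.mono (Icc_subset_Icc_right hst.le)
    have h1 : Wval f β ub u₀ lf (γ s) s ≤
        runCost f β ub lf γ 0 s + ∫ y in (0:ℝ)..(γ 0), u₀ y :=
      csInf_le ⟨_, hlow s (γ s) hs hst.le⟩
        ⟨γ, K, hγs, rfl, fun θ hθ => hγpos θ ⟨hθ.1, hθ.2.trans hst.le⟩, rfl⟩
    have h2 : Wvals f β ub u₀ lf x t s ≤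
        runCost f β ub lf γ s t + Wval f β ub u₀ lf (γ s) s := by
      refine csInf_le ⟨-M * x - C * t, ?_⟩ ⟨γ, K, hγ.mono (Icc_subset_Icc_left hs), hγt,
        fun θ hθ => hγpos θ ⟨hs.trans hθ.1, hθ.2⟩, rfl⟩
      rintro d ⟨η, L, hη, rfl, hηpos, rfl⟩
      have e1 := hC η L s t hs hst.le le_rfl hη hηpos
      have e2 : -M * η s - C * s ≤ Wval f β ub u₀ lf (η s) s :=
        le_csInf (hne s _ (hηpos s ⟨le_rfl, hst.le⟩)) (hlow s (η s) hs hst.le)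
      linarith
    rw [runCost_add hfc hsuper hβ hub hubm hs hst.le hγ]
    linarith
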